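/- Let H be a subgroup of a hyperbolic group G with limit set Λ ⊂ ∂G, and let ℒ be the collection of translates gΛ of Λ by representatives of distinct cosets of H (one for each coset, counted with multiplicity). Then H is quasiconvex in G if and only if ℒ is a discrete subset of C_c⁰(∂G). -/

import Mathlib

/-!
Common coarse-geometric definitions used to formalize statements from
"Relative Rigidity, Quasiconvexity and C-Complexes" (Mahan Mj).

We model the Cayley graph of a finitely generated group by the group itself
equipped with a word metric (the vertex set of the Cayley graph, with
bi-infinite geodesics modelled by `ℤ`-parametrized discrete geodesics), and we
set up all basic notions (Gromov products, hyperbolicity, the Gromov boundary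
via Gromov sequences, limit sets, joins, quasiconvexity, electric metrics and
relative hyperbolicity à la Farb, uniformly proper maps, quasi-isometries)
relative to an abstract distance function `d : α → α → ℝ`.
-/

open Filter Set Metric
open scoped ENNReal

noncomputable section

namespace RelRig

universe u v

variable {α β : Type*}

/-- Gromov product of `x`, `y` based at `w`. -/
def gpD (d : α → α → ℝ) (w x y : α) : ℝ := (d w x + d w y - d x y) / 2

/-- `d` satisfies the Gromov four-point condition with constant `δ`. -/
def DeltaHypD (d : α → α → ℝ) (δ : ℝ) : Prop :=
  ∀ w x y z : α, min (gpD d w x y) (gpD d w y z) - δ ≤ gpD d w x z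

/-- `d` is Gromov-hyperbolic. -/
def HypD (d : α → α → ℝ) : Prop := ∃ δ ≥ (0 : ℝ), DeltaHypD d δ

/-- distance from a point to a set. -/
def pdistD (d : α → α → ℝ) (x : α) (A : Set α) : ℝ := sInf {r | ∃ a ∈ A, r = d x a}

/-- (infimal) distance between two sets. -/
def setDistD (d : α → α → ℝ) (A B : Set α) : ℝ := sInf {r | ∃ a ∈ A, ∃ b ∈ B, r = d a b}

/-- closed `r`-neighbourhood of a set. -/
def nbdD (d : α → α → ℝ) (r : ℝ) (A : Set α) : Set α := {x | ∃ a ∈ A, d x a ≤ r}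

/-- a sequence going to infinity (a "Gromov sequence"). -/
def GromovSeqD (d : α → α → ℝ) (w : α) (s : ℕ → α) : Prop :=
  Tendsto (fun p : ℕ × ℕ => gpD d w (s p.1) (s p.2)) atTop atTop

/-- asymptoticity of Gromov sequences. -/
def bdryRelD (d : α → α → ℝ) (w : α) (s t : {u : ℕ → α // GromovSeqD d w u}) : Prop :=
  Tendsto (fun p : ℕ × ℕ => gpD d w (s.1 p.1) (t.1 p.2)) atTop atTop

/-- The Gromov boundary of `(α, d)`: asymptoticity classes of Gromov sequences. -/
def BdryD (d : α → α → ℝ) (w : α) := Quot (bdryRelD d w)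

/-- `s` converges to the boundary point `ξ`. -/
def ConvTo (d : α → α → ℝ) (w : α) (s : ℕ → α) (ξ : BdryD d w) : Prop :=
  ∃ hs : GromovSeqD d w s, Quot.mk (bdryRelD d w) ⟨s, hs⟩ = ξ

/-- the limit set of a subset `A ⊆ α` in the Gromov boundary. -/
def limitSetD (d : α → α → ℝ) (w : α) (A : Set α) : Set (BdryD d w) :=
  {ξ | ∃ s : ℕ → α, (∀ n, s n ∈ A) ∧ ConvTo d w s ξ}

/-- Gromov product of two boundary points. -/
def bgpD (d : α → α → ℝ) (w : α) (ξ η : BdryD d w) : ℝ≥0∞ :=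
  ⨆ s : {s : ℕ → α // ConvTo d w s ξ}, ⨆ t : {t : ℕ → α // ConvTo d w t η},
    Filter.liminf (fun p : ℕ × ℕ => ENNReal.ofReal (gpD d w (s.1 p.1) (t.1 p.2))) atTop

open Classical in
/-- the visual (quasi-)metric on the boundary. -/
def vdistD (d : α → α → ℝ) (w : α) (ξ η : BdryD d w) : ℝ :=
  if ξ = η then 0 else Real.exp (-(bgpD d w ξ η).toReal)

/-- visual diameter of a subset of the boundary. -/
def vdiamD (d : α → α → ℝ) (w : α) (Λ : Set (BdryD d w)) : ℝ :=
  sSup {r | ∃ ξ ∈ Λ, ∃ η ∈ Λ, r = vdistD d w ξ η}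

/-- Hausdorff distance between two subsets of the boundary (visual metric). -/
def vHdistD (d : α → α → ℝ) (w : α) (A B : Set (BdryD d w)) : ℝ :=
  max (sSup {r | ∃ a ∈ A, r = sInf {t | ∃ b ∈ B, t = vdistD d w a b}})
      (sSup {r | ∃ b ∈ B, r = sInf {t | ∃ a ∈ A, t = vdistD d w a b}})

/-- closed subsets of the boundary w.r.t. the visual metric. -/
def VClosed (d : α → α → ℝ) (w : α) (K : Set (BdryD d w)) : Prop :=
  ∀ ξ : BdryD d w, (∀ ε > (0 : ℝ), ∃ η ∈ K, vdistD d w ξ η < ε) → ξ ∈ K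

/-- A family (multiset) of boundary subsets is a discrete subset of `C_c⁰(∂X)`,
the space of closed subsets of the boundary having more than one point, with the
Hausdorff topology: the family does not accumulate (with multiplicity) at any
closed subset of the boundary having more than one point. -/
def DiscreteFamilyD {ι : Type*} (d : α → α → ℝ) (w : α) (L : ι → Set (BdryD d w)) : Prop :=
  ∀ K : Set (BdryD d w), VClosed d w K → K.Nontrivial →
    ¬ (∀ ε > (0 : ℝ), {i : ι | vHdistD d w (L i) K < ε}.Infinite)

/-- discrete geodesic of length `m` (suitable for graphs/word metrics). -/
def DiscGeodD (d : α → α → ℝ) (c : ℕ → α) (m : ℕ) : Prop :=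
  ∀ i, i ≤ m → ∀ j, j ≤ m → d (c i) (c j) = |(i : ℝ) - (j : ℝ)|

/-- discrete bi-infinite geodesic. -/
def DiscLineD (d : α → α → ℝ) (γ : ℤ → α) : Prop :=
  ∀ i j : ℤ, d (γ i) (γ j) = |(i : ℝ) - (j : ℝ)|

/-- `A` is a `K`-quasiconvex subset: every (discrete) geodesic with endpoints
in `A` stays in the `K`-neighbourhood of `A`. -/
def QCSetD (d : α → α → ℝ) (K : ℝ) (A : Set α) : Prop :=
  ∀ (c : ℕ → α) (m : ℕ), DiscGeodD d c m → c 0 ∈ A → c m ∈ A →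
    ∀ i, i ≤ m → pdistD d (c i) A ≤ K

/-- both endpoints of the bi-infinite geodesic `γ` lie in `Λ`. -/
def LineEndsInD (d : α → α → ℝ) (w : α) (γ : ℤ → α) (Λ : Set (BdryD d w)) : Prop :=
  (∃ ξ ∈ Λ, ConvTo d w (fun n : ℕ => γ (n : ℤ)) ξ) ∧
  (∃ η ∈ Λ, ConvTo d w (fun n : ℕ => γ (-(n : ℤ))) η)

/-- the join `J(Λ)`: the union of all bi-infinite geodesics with both endpoints in `Λ`. -/
def joinD (d : α → α → ℝ) (w : α) (Λ : Set (BdryD d w)) : Set α :=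
  {p | ∃ γ : ℤ → α, DiscLineD d γ ∧ LineEndsInD d w γ Λ ∧ p ∈ Set.range γ}

/-- a nearest-point projection onto `A`. -/
def IsNearestProjD (d : α → α → ℝ) (A : Set α) (P : α → α) : Prop :=
  ∀ x : α, P x ∈ A ∧ ∀ a ∈ A, d x (P x) ≤ d x a

/-- uniformly proper pairing of two collections of subsets (Schwarz, Mj). -/
def UProperD {ι κ : Type*} (d₁ : α → α → ℝ) (d₂ : β → β → ℝ)
    (J₁ : ι → Set α) (J₂ : κ → Set β) (φ : ι → κ) : Prop :=
  ∃ f : ℕ → ℕ, ∀ (n : ℕ) (i i' : ι),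
    (setDistD d₁ (J₁ i) (J₁ i') ≤ (n : ℝ) →
      setDistD d₂ (J₂ (φ i)) (J₂ (φ i')) ≤ (f n : ℝ)) ∧
    (setDistD d₂ (J₂ (φ i)) (J₂ (φ i')) ≤ (n : ℝ) →
      setDistD d₁ (J₁ i) (J₁ i') ≤ (f n : ℝ))

/-- `q` pairs the collections `J₁`, `J₂` as `φ` does. -/
def PairsAsD {ι κ : Type*} (d₁ : α → α → ℝ) (d₂ : β → β → ℝ)
    (q : α → β) (J₁ : ι → Set α) (J₂ : κ → Set β) (φ : ι → κ) : Prop :=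
  ∃ h : ℕ → ℕ, ∀ (n : ℕ) (p : α) (i : ι),
    pdistD d₁ p (J₁ i) ≤ (n : ℝ) → pdistD d₂ (q p) (J₂ (φ i)) ≤ (h n : ℝ)

/-- quasi-isometry between `(α, d₁)` and `(β, d₂)`. -/
def QIMapD (d₁ : α → α → ℝ) (d₂ : β → β → ℝ) (q : α → β) : Prop :=
  ∃ lam C : ℝ, 1 ≤ lam ∧ 0 ≤ C ∧
    (∀ x y : α, d₂ (q x) (q y) ≤ lam * d₁ x y + C ∧ d₁ x y ≤ lam * d₂ (q x) (q y) + C) ∧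
    (∀ z : β, ∃ x : α, d₂ z (q x) ≤ C)

/-! ### Word metrics, quasiconvex subgroups, limit sets of cosets -/

section Groups
variable {G : Type*} [Group G]

/-- the word metric associated to a (symmetrized) generating set `S`. -/
def wdist (S : Set G) (g h : G) : ℝ :=
  sInf {r | ∃ l : List G, (∀ x ∈ l, x ∈ S ∨ x⁻¹ ∈ S) ∧ l.prod = g⁻¹ * h ∧ r = (l.length : ℝ)}

/-- the left coset `gH` as a subset of `G`. -/
def cosetSet (H : Subgroup G) (g : G) : Set G := {x | g⁻¹ * x ∈ H}

/-- `R` contains exactly one representative of each left coset of `H`. -/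
def IsCosetReps (H : Subgroup G) (R : Set G) : Prop :=
  ∀ g : G, ∃! r : G, r ∈ R ∧ g⁻¹ * r ∈ H

/-- the translate `gΛ(H)` of the limit set of `H` in the Gromov boundary:
the limit set of the coset `gH`. -/
def cosetLimitSet (S : Set G) (H : Subgroup G) (g : G) : Set (BdryD (wdist S) (1 : G)) :=
  limitSetD (wdist S) 1 (cosetSet H g)

/-- the join `J(gΛ(H))` of the translate `gΛ(H)` of the limit set of `H`. -/
def cosetJoin (S : Set G) (H : Subgroup G) (g : G) : Set G :=
  joinD (wdist S) 1 (cosetLimitSet S H g)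

/-- quasiconvex subgroup w.r.t. the word metric of `S`. -/
def QCSubgroup (S : Set G) (H : Subgroup G) : Prop :=
  ∃ C ≥ (0 : ℝ), QCSetD (wdist S) C (H : Set G)

/-- malnormal subgroup: `gHg⁻¹ ∩ H` is trivial for `g ∉ H`. -/
def Malnormal (H : Subgroup G) : Prop :=
  ∀ g : G, g ∉ H → ∀ x : G, x ∈ H → g * x * g⁻¹ ∈ H → x = 1

end Groups

/-! ### Relative hyperbolicity (Farb: electric space + bounded penetration) -/

section RelHyp
variable {α : Type*}

open Classical in
/-- cost of one step of an electric chain: travelling within a horosphere-like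
set costs at most `1` (passing through the cone point). -/
def stepCost (d : α → α → ℝ) (ℋ : Set (Set α)) (a b : α) : ℝ :=
  if ∃ H ∈ ℋ, a ∈ H ∧ b ∈ H then min 1 (d a b) else d a b

/-- electric length of the portion `[i, j]` of a chain. -/
def chainLen (d : α → α → ℝ) (ℋ : Set (Set α)) (p : ℕ → α) (i j : ℕ) : ℝ :=
  ∑ k ∈ Finset.Ico i j, stepCost d ℋ (p k) (p (k + 1))

/-- the electric (coned-off) pseudo-metric of Farb's electric space. -/
def elDist (d : α → α → ℝ) (ℋ : Set (Set α)) (x y : α) : ℝ :=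
  sInf {r | ∃ (n : ℕ) (p : ℕ → α), p 0 = x ∧ p n = y ∧ r = chainLen d ℋ p 0 n}

/-- weak relative hyperbolicity: the electric space is hyperbolic. -/
def WeakRelHyp (d : α → α → ℝ) (ℋ : Set (Set α)) : Prop := HypD (elDist d ℋ)

/-- an electric `P`-quasigeodesic chain. -/
def ElQG (d : α → α → ℝ) (ℋ : Set (Set α)) (P : ℝ) (p : ℕ → α) (n : ℕ) : Prop :=
  ∀ i j : ℕ, i ≤ j → j ≤ n → chainLen d ℋ p i j ≤ P * elDist d ℋ (p i) (p j) + P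

/-- the chain does not return to the `ε`-neighbourhood of any horosphere-like
set after leaving it. -/
def NoBacktrack (d : α → α → ℝ) (ℋ : Set (Set α)) (ε : ℝ) (p : ℕ → α) (n : ℕ) : Prop :=
  ∀ H ∈ ℋ, ∀ i j k : ℕ, i < j → j < k → k ≤ n →
    p i ∈ nbdD d ε H → p k ∈ nbdD d ε H → p j ∈ nbdD d ε H

/-- the chain meets `S`. -/
def MeetsChain (p : ℕ → α) (n : ℕ) (S : Set α) : Prop := ∃ i ≤ n, p i ∈ S

/-- `i` is the entry point of the chain into the `ε`-neighbourhood of `H`. -/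
def IsEntry (d : α → α → ℝ) (ε : ℝ) (H : Set α) (p : ℕ → α) (n i : ℕ) : Prop :=
  i ≤ n ∧ p i ∈ nbdD d ε H ∧ ∀ j, j < i → p j ∉ nbdD d ε H

/-- `i` is the exit point of the chain from the `ε`-neighbourhood of `H`. -/
def IsExit (d : α → α → ℝ) (ε : ℝ) (H : Set α) (p : ℕ → α) (n i : ℕ) : Prop :=
  i ≤ n ∧ p i ∈ nbdD d ε H ∧ ∀ j, i < j → j ≤ n → p j ∉ nbdD d ε H

/-- coarse intrinsic path-metric of a subset `S`. -/
def inDist (d : α → α → ℝ) (S : Set α) (x y : α) : ℝ :=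
  sInf {r | ∃ (n : ℕ) (p : ℕ → α), p 0 = x ∧ p n = y ∧ (∀ i, i ≤ n → p i ∈ S) ∧
    (∀ i, i < n → d (p i) (p (i + 1)) ≤ 1) ∧
    r = ∑ k ∈ Finset.range n, d (p k) (p (k + 1))}

/-- Bounded penetration: electric quasigeodesics without backtracking with the
same endpoints have similar intersection patterns with horosphere-like sets. -/
def BddPenetration (d : α → α → ℝ) (ℋ : Set (Set α)) : Prop :=
  ∀ P ≥ (1 : ℝ), ∃ ε ≥ (0 : ℝ), ∃ D ≥ (0 : ℝ),
    ∀ (p q : ℕ → α) (n m : ℕ), p 0 = q 0 → p n = q m →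
      ElQG d ℋ P p n → ElQG d ℋ P q m →
      NoBacktrack d ℋ ε p n → NoBacktrack d ℋ ε q m →
      ∀ H ∈ ℋ,
        (¬ MeetsChain q m (nbdD d ε H) →
          ∀ i j, IsEntry d ε H p n i → IsExit d ε H p n j →
            inDist d (nbdD d ε H) (p i) (p j) ≤ D) ∧
        (MeetsChain q m (nbdD d ε H) →
          (∀ i j, IsEntry d ε H p n i → IsEntry d ε H q m j →
            inDist d (nbdD d ε H) (p i) (q j) ≤ D) ∧
          (∀ i j, IsExit d ε H p n i → IsExit d ε H q m j →
            inDist d (nbdD d ε H) (p i) (q j) ≤ D))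

/-- the collection `ℋ` is uniformly separated. -/
def UnifSeparated (d : α → α → ℝ) (ℋ : Set (Set α)) : Prop :=
  ∃ ε > (0 : ℝ), ∀ H₁ ∈ ℋ, ∀ H₂ ∈ ℋ, H₁ ≠ H₂ → ε ≤ setDistD d H₁ H₂

/-- strong relative hyperbolicity (Farb's definition; equivalent to Gromov's
definition via hyperbolic cones, by Bowditch). -/
def StrongRelHyp (d : α → α → ℝ) (ℋ : Set (Set α)) : Prop :=
  UnifSeparated d ℋ ∧ WeakRelHyp d ℋ ∧ BddPenetration d ℋ

end RelHyp

/-! ### Geodesic metric spaces, CAT(0) spaces, flats, symmetric spaces -/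

section MetricGeo
variable {X : Type*} [MetricSpace X]

/-- `γ` is a unit-speed parametrization of a geodesic from `x` to `y`. -/
def GeodParam (γ : ℝ → X) (x y : X) : Prop :=
  γ 0 = x ∧ γ (dist x y) = y ∧
    ∀ s ∈ Icc (0 : ℝ) (dist x y), ∀ t ∈ Icc (0 : ℝ) (dist x y), dist (γ s) (γ t) = |s - t|

/-- `s` is (the image of) a geodesic segment from `x` to `y`. -/
def IsGeodSeg (x y : X) (s : Set X) : Prop :=
  ∃ γ : ℝ → X, GeodParam γ x y ∧ s = γ '' Icc (0 : ℝ) (dist x y)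

/-- geodesic metric space. -/
def GeodesicSpace (X : Type*) [MetricSpace X] : Prop := ∀ x y : X, ∃ s : Set X, IsGeodSeg x y s

/-- `A` is a `K`-quasiconvex subset of the metric space `X`. -/
def QCSet (K : ℝ) (A : Set X) : Prop :=
  ∀ x ∈ A, ∀ y ∈ A, ∀ s : Set X, IsGeodSeg x y s → ∀ p ∈ s, Metric.infDist p A ≤ K

/-- `γ` is a bi-infinite (unit-speed) geodesic. -/
def IsGeodLine (γ : ℝ → X) : Prop := ∀ a b : ℝ, dist (γ a) (γ b) = |a - b|

/-- both endpoints of the geodesic line `γ` lie in `Λ`. -/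
def lineEndsIn (w : X) (γ : ℝ → X) (Λ : Set (BdryD (fun x y : X => dist x y) w)) : Prop :=
  (∃ ξ ∈ Λ, ConvTo (fun x y : X => dist x y) w (fun n : ℕ => γ (n : ℝ)) ξ) ∧
  (∃ η ∈ Λ, ConvTo (fun x y : X => dist x y) w (fun n : ℕ => γ (-(n : ℝ))) η)

/-- the join of `Λ ⊆ ∂X`: the union of bi-infinite geodesics with endpoints in `Λ`. -/
def joinR (w : X) (Λ : Set (BdryD (fun x y : X => dist x y) w)) : Set X :=
  {p | ∃ γ : ℝ → X, IsGeodLine γ ∧ lineEndsIn w γ Λ ∧ p ∈ Set.range γ}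

/-- CAT(0) space, via the CN (Bruhat–Tits) midpoint inequality. -/
def CAT0 (X : Type*) [MetricSpace X] : Prop :=
  GeodesicSpace X ∧ ∀ x y z m : X, dist y m = dist y z / 2 → dist z m = dist y z / 2 →
    dist x m ^ 2 ≤ (dist x y ^ 2 + dist x z ^ 2) / 2 - dist y z ^ 2 / 4

/-- a `k`-flat: an isometrically embedded copy of Euclidean `k`-space. -/
def FlatOfDim (k : ℕ) (F : Set X) : Prop :=
  ∃ f : EuclideanSpace ℝ (Fin k) → X, Isometry f ∧ Set.range f = F

/-- a flat (of dimension at least 2). -/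
def IsFlat2 (F : Set X) : Prop := ∃ k : ℕ, 2 ≤ k ∧ FlatOfDim k F

/-- a maximal flat. -/
def IsMaxFlat (F : Set X) : Prop := IsFlat2 F ∧ ∀ F' : Set X, IsFlat2 F' → F ⊆ F' → F' = F

/-- isolated flats: every flat is uniformly close to a maximal one, and
neighbourhoods of distinct maximal flats have uniformly bounded overlap. -/
def IsolatedFlats (X : Type*) [MetricSpace X] : Prop :=
  (∃ D ≥ (0 : ℝ), ∀ F : Set X, IsFlat2 F →
    ∃ F' : Set X, IsMaxFlat F' ∧ ∀ x ∈ F, Metric.infDist x F' ≤ D) ∧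
  (∀ ρ ≥ (0 : ℝ), ∃ κ ≥ (0 : ℝ), ∀ F F' : Set X, IsMaxFlat F → IsMaxFlat F' → F ≠ F' →
    ∀ x y : X, Metric.infDist x F ≤ ρ → Metric.infDist x F' ≤ ρ →
      Metric.infDist y F ≤ ρ → Metric.infDist y F' ≤ ρ → dist x y ≤ κ)

/-- a (globally) symmetric space of non-positive curvature: a CAT(0) space with
a geodesic point-symmetry at every point. -/
def SymmSpaceNonpos (X : Type*) [MetricSpace X] : Prop :=
  CAT0 X ∧ ∀ x : X, ∃ σ : X ≃ᵢ X, σ x = x ∧ ∀ y : X, dist y (σ y) = 2 * dist x y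

/-- `X` has rank `r`: it contains an `r`-flat but no `(r+1)`-flat. -/
def HasRank (X : Type*) [MetricSpace X] (r : ℕ) : Prop :=
  (∃ F : Set X, FlatOfDim r F) ∧ ∀ F : Set X, ¬ FlatOfDim (r + 1) F

end MetricGeo

/-! ### Group actions -/

/-- a geometric action: by isometries, metrically proper and cobounded. -/
def GeometricAction (G : Type*) [Group G] (X : Type*) [MetricSpace X] [MulAction G X] : Prop :=
  (∀ g : G, Isometry (fun x : X => g • x)) ∧
  (∀ x₀ : X, ∀ r : ℝ, {g : G | dist x₀ (g • x₀) ≤ r}.Finite) ∧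
  (∀ x₀ : X, ∃ C : ℝ, ∀ x : X, ∃ g : G, dist x (g • x₀) ≤ C)

/-- `𝒥` is the `G`-equivariant family of lifts of a maximal totally geodesic
torus (of dimension `r = rank`) in the compact locally symmetric space `X/G`:
an orbit of a periodic `r`-flat. -/
def TorusLiftFamily (G : Type*) [Group G] {X : Type*} [MetricSpace X] [MulAction G X]
    (r : ℕ) (𝒥 : Set (Set X)) : Prop :=
  (∀ J ∈ 𝒥, FlatOfDim r J) ∧
  (∃ F₀ ∈ 𝒥, 𝒥 = {J : Set X | ∃ g : G, J = (fun x : X => g • x) '' F₀}) ∧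
  (∃ C ≥ (0 : ℝ), ∀ J ∈ 𝒥, ∀ x ∈ J, ∀ y ∈ J,
    ∃ g : G, (fun z : X => g • z) '' J = J ∧ dist x (g • y) ≤ C)

/-! ### Convergence groups, annulus systems and cross-ratios (Bowditch) -/

/-- the space of distinct triples of `M`. -/
def distinctTriples (M : Type*) : Set (M × M × M) :=
  {p | p.1 ≠ p.2.1 ∧ p.1 ≠ p.2.2 ∧ p.2.1 ≠ p.2.2}

/-- the diagonal action on triples. -/
def tripleAct {G M : Type*} [Group G] [MulAction G M] (g : G) (p : M × M × M) : M × M × M :=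
  (g • p.1, g • p.2.1, g • p.2.2)

/-- a uniform convergence group action: the action on the space of distinct
triples is properly discontinuous and cocompact. -/
def UniformConvergenceAction (G : Type*) [Group G] (M : Type*) [TopologicalSpace M]
    [MulAction G M] : Prop :=
  (∀ g : G, Continuous (fun x : M => g • x)) ∧
  (∀ K : Set (M × M × M), K ⊆ distinctTriples M → IsCompact K →
    {g : G | (tripleAct g '' K ∩ K).Nonempty}.Finite) ∧
  (∃ K : Set (M × M × M), K ⊆ distinctTriples M ∧ IsCompact K ∧
    ∀ p ∈ distinctTriples M, ∃ g : G, tripleAct g p ∈ K)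

/-- an (unconstrained) ordered pair of subsets of `M`. -/
structure Ann (M : Type*) where
  minus : Set M
  plus : Set M

/-- `A` is an annulus: an ordered pair of disjoint closed subsets not covering `M`. -/
def IsAnnulusOn (M : Type*) [TopologicalSpace M] (A : Ann M) : Prop :=
  IsClosed A.minus ∧ IsClosed A.plus ∧ Disjoint A.minus A.plus ∧ A.minus ∪ A.plus ≠ Set.univ

/-- translate of an annulus. -/
def annAct {G M : Type*} [Group G] [MulAction G M] (g : G) (A : Ann M) : Ann M :=
  ⟨(fun x : M => g • x) '' A.minus, (fun x : M => g • x) '' A.plus⟩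

/-- a nested chain of `m` annuli of `𝒜` separating `K` from `L`:
`K < A₁ < ⋯ < A_m < L`. -/
def SepChain {M : Type*} [TopologicalSpace M] (𝒜 : Set (Ann M)) (K L : Set M) (m : ℕ) : Prop :=
  m = 0 ∨ ∃ A : ℕ → Ann M, (∀ i, i < m → A i ∈ 𝒜) ∧
    K ⊆ interior (A 0).minus ∧ L ⊆ interior (A (m - 1)).plus ∧
    ∀ i, i + 1 < m → interior (A i).minus ∪ interior (A (i + 1)).plus = Set.univ

/-- the annular cross-ratio `(K|L)_𝒜 ∈ ℕ ∪ {∞}`. -/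
def crossRatioAnn {M : Type*} [TopologicalSpace M] (𝒜 : Set (Ann M)) (K L : Set M) : ℕ∞ :=
  sSup {n : ℕ∞ | ∃ m : ℕ, n = (m : ℕ∞) ∧ SepChain 𝒜 K L m}

/-- the limit set of a subgroup of a convergence group. -/
def convLimitSet {G : Type*} [Group G] {M : Type*} [TopologicalSpace M] [MulAction G M]
    (H : Subgroup G) : Set M :=
  {ξ : M | ∃ h : ℕ → H, Function.Injective h ∧
    ∃ x : M, Tendsto (fun n => (h n : G) • x) atTop (nhds ξ)}

/-- discreteness of a family (multiset) of subsets of a metrizable compactum `M`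
in the Hausdorff topology on the space of closed subsets of `M` with more than
one point. -/
def DiscreteFamilyM {ι M : Type*} [MetricSpace M] (L : ι → Set M) : Prop :=
  ∀ K : Set M, IsClosed K → K.Nontrivial →
    ¬ (∀ ε > (0 : ℝ), {i : ι | Metric.hausdorffDist (L i) K < ε}.Infinite)

/-- uniform properness of a pairing with respect to annular cross-ratios. -/
def UProperCRFam {ι κ M₁ M₂ : Type*} [TopologicalSpace M₁] [TopologicalSpace M₂]
    (𝒜₁ : Set (Ann M₁)) (𝒜₂ : Set (Ann M₂))
    (L₁ : ι → Set M₁) (L₂ : κ → Set M₂) (φ : ι → κ) : Prop :=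
  ∃ f : ℕ → ℕ, ∀ (n : ℕ) (i i' : ι),
    (crossRatioAnn 𝒜₁ (L₁ i) (L₁ i') ≤ (n : ℕ∞) →
      crossRatioAnn 𝒜₂ (L₂ (φ i)) (L₂ (φ i')) ≤ (f n : ℕ∞)) ∧
    (crossRatioAnn 𝒜₂ (L₂ (φ i)) (L₂ (φ i')) ≤ (n : ℕ∞) →
      crossRatioAnn 𝒜₁ (L₁ i) (L₁ i') ≤ (f n : ℕ∞))

/-! ### Helper lemmas -/

section Helpers

/-- the basic pseudometric laws for `d`. -/
structure PMet (d : α → α → ℝ) : Prop where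
  self : ∀ x, d x x = 0
  symm : ∀ x y, d x y = d y x
  tri : ∀ x y z, d x z ≤ d x y + d y z
  nonneg : ∀ x y, 0 ≤ d x y

lemma tend2_iff (f : ℕ → ℕ → ℝ) :
    Tendsto (fun p : ℕ × ℕ => f p.1 p.2) atTop atTop ↔
      ∀ r : ℝ, ∃ N, ∀ i ≥ N, ∀ j ≥ N, r ≤ f i j := by
  rw [tendsto_atTop_atTop]
  constructor
  · intro h r
    obtain ⟨⟨a, b⟩, hab⟩ := h r
    refine ⟨max a b, fun i hi j hj => hab (i, j) ⟨?_, ?_⟩⟩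
    · exact le_trans (le_max_left _ _) hi
    · exact le_trans (le_max_right _ _) hj
  · intro h r
    obtain ⟨N, hN⟩ := h r
    exact ⟨(N, N), fun p hp => hN p.1 hp.1 p.2 hp.2⟩

lemma event2_iff (P : ℕ → ℕ → Prop) :
    (∀ᶠ p : ℕ × ℕ in atTop, P p.1 p.2) ↔ ∃ N, ∀ i ≥ N, ∀ j ≥ N, P i j := by
  rw [eventually_atTop]
  constructor
  · rintro ⟨⟨a, b⟩, hab⟩
    refine ⟨max a b, fun i hi j hj => hab (i, j) ⟨?_, ?_⟩⟩
    · exact le_trans (le_max_left _ _) hi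
    · exact le_trans (le_max_right _ _) hj
  · rintro ⟨N, hN⟩
    exact ⟨(N, N), fun p hp => hN p.1 hp.1 p.2 hp.2⟩

lemma PMet.gp_symm {d : α → α → ℝ} (hd : PMet d) (w x y : α) :
    gpD d w x y = gpD d w y x := by
  unfold gpD
  rw [hd.symm x y]; ring

lemma gromov_iff {d : α → α → ℝ} {w : α} {s : ℕ → α} :
    GromovSeqD d w s ↔ ∀ r : ℝ, ∃ N, ∀ i ≥ N, ∀ j ≥ N, r ≤ gpD d w (s i) (s j) :=
  tend2_iff (fun i j => gpD d w (s i) (s j))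

lemma hyp_le {d : α → α → ℝ} {δ : ℝ} (hδ : DeltaHypD d δ) {w x y z : α} {a : ℝ}
    (h1 : a ≤ gpD d w x y) (h2 : a ≤ gpD d w y z) : a - δ ≤ gpD d w x z := by
  have := hδ w x y z
  have := le_min h1 h2
  linarith

lemma rel_iff {d : α → α → ℝ} {w : α} {s t : {u : ℕ → α // GromovSeqD d w u}} :
    bdryRelD d w s t ↔ ∀ r : ℝ, ∃ N, ∀ i ≥ N, ∀ j ≥ N, r ≤ gpD d w (s.1 i) (t.1 j) :=
  tend2_iff (fun i j => gpD d w (s.1 i) (t.1 j))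

lemma rel_equiv {d : α → α → ℝ} (hd : PMet d) {δ : ℝ} (hδ : DeltaHypD d δ) (w : α) :
    Equivalence (bdryRelD d w) where
  refl s := s.2
  symm := by
    intro s t h
    rw [rel_iff] at h ⊢
    intro r
    obtain ⟨N, hN⟩ := h r
    refine ⟨N, fun i hi j hj => ?_⟩
    rw [hd.gp_symm]; exact hN j hj i hi
  trans := by
    intro s t u h1 h2
    rw [rel_iff] at h1 h2 ⊢
    intro r
    obtain ⟨N, hN⟩ := h1 (r + δ)
    obtain ⟨M, hM⟩ := h2 (r + δ)
    refine ⟨max N M, fun i hi j hj => ?_⟩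
    have := hyp_le hδ (hN i (le_trans (le_max_left _ _) hi) (max N M) (le_max_left _ _))
      (hM (max N M) (le_max_right _ _) j (le_trans (le_max_right _ _) hj))
    linarith

lemma mk_eq_iff {d : α → α → ℝ} (hd : PMet d) {δ : ℝ} (hδ : DeltaHypD d δ) {w : α}
    (s t : {u : ℕ → α // GromovSeqD d w u}) :
    Quot.mk (bdryRelD d w) s = Quot.mk (bdryRelD d w) t ↔ bdryRelD d w s t := by
  constructor
  · intro h
    exact (rel_equiv hd hδ w).eqvGen_iff.1 (Quot.eqvGen_exact h)
  · exact Quot.sound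

/-- Two sequences with the same limit are asymptotic. -/
lemma ConvTo.asymp {d : α → α → ℝ} (hd : PMet d) {δ : ℝ} (hδ : DeltaHypD d δ) {w : α}
    {s t : ℕ → α} {ξ : BdryD d w} (hs : ConvTo d w s ξ) (ht : ConvTo d w t ξ) (r : ℝ) :
    ∃ N, ∀ i ≥ N, ∀ j ≥ N, r ≤ gpD d w (s i) (t j) := by
  obtain ⟨hs, h1⟩ := hs
  obtain ⟨ht, h2⟩ := ht
  have := (mk_eq_iff hd hδ ⟨s, hs⟩ ⟨t, ht⟩).1 (h1.trans h2.symm)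
  exact rel_iff.1 this r

lemma exists_conv {d : α → α → ℝ} {w : α} (ξ : BdryD d w) : ∃ s, ConvTo d w s ξ := by
  induction ξ using Quot.ind with
  | mk s => exact ⟨s.1, s.2, rfl⟩

/-- `ξ` and `η` have Gromov product at least `r`, for some representatives. -/
def Near (d : α → α → ℝ) (w : α) (r : ℝ) (ξ η : BdryD d w) : Prop :=
  ∃ s t : ℕ → α, ConvTo d w s ξ ∧ ConvTo d w t η ∧
    ∃ N, ∀ i ≥ N, ∀ j ≥ N, r ≤ gpD d w (s i) (t j)

lemma Near.symm {d : α → α → ℝ} (hd : PMet d) {w : α} {r : ℝ} {ξ η : BdryD d w}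
    (h : Near d w r ξ η) : Near d w r η ξ := by
  obtain ⟨s, t, hs, ht, N, hN⟩ := h
  refine ⟨t, s, ht, hs, N, fun i hi j hj => ?_⟩
  rw [hd.gp_symm]; exact hN j hj i hi

lemma Near.mono {d : α → α → ℝ} {w : α} {r r' : ℝ} {ξ η : BdryD d w}
    (h : Near d w r ξ η) (hr : r' ≤ r) : Near d w r' ξ η := by
  obtain ⟨s, t, hs, ht, N, hN⟩ := h
  exact ⟨s, t, hs, ht, N, fun i hi j hj => hr.trans (hN i hi j hj)⟩

lemma near_refl {d : α → α → ℝ} {w : α} (r : ℝ) (ξ : BdryD d w) : Near d w r ξ ξ := by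
  obtain ⟨s, hs⟩ := exists_conv ξ
  obtain ⟨h, -⟩ := id hs
  exact ⟨s, s, hs, hs, gromov_iff.1 h r⟩

lemma Near.forall {d : α → α → ℝ} (hd : PMet d) {δ : ℝ} (hδ0 : 0 ≤ δ) (hδ : DeltaHypD d δ) {w : α}
    {r : ℝ} {ξ η : BdryD d w} (h : Near d w r ξ η) {s t : ℕ → α} (hs : ConvTo d w s ξ)
    (ht : ConvTo d w t η) : ∃ N, ∀ i ≥ N, ∀ j ≥ N, r - 2 * δ ≤ gpD d w (s i) (t j) := by
  obtain ⟨s', t', hs', ht', N, hN⟩ := h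
  obtain ⟨A, hA⟩ := hs.asymp hd hδ hs' r
  obtain ⟨B, hB⟩ := ht'.asymp hd hδ ht r
  refine ⟨max A (max B N), fun i hi j hj => ?_⟩
  have e1 : A ≤ max A (max B N) := le_max_left _ _
  have e2 : B ≤ max A (max B N) := (le_max_left _ _).trans (le_max_right _ _)
  have e3 : N ≤ max A (max B N) := (le_max_right _ _).trans (le_max_right _ _)
  generalize max A (max B N) = M at *
  have h1 := hyp_le hδ (hA i (e1.trans hi) M e1) (hN M e3 M e3)
  have h2 := hB M e2 j (e2.trans hj)
  have := hyp_le hδ h1 (show r - δ ≤ _ by linarith)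
  linarith

lemma Near.trans {d : α → α → ℝ} (hd : PMet d) {δ : ℝ} (hδ0 : 0 ≤ δ) (hδ : DeltaHypD d δ) {w : α}
    {r : ℝ} {ξ η ζ : BdryD d w} (h : Near d w r ξ η) (h' : Near d w r η ζ) :
    Near d w (r - 3 * δ) ξ ζ := by
  obtain ⟨s, hs⟩ := exists_conv ξ
  obtain ⟨t, ht⟩ := exists_conv η
  obtain ⟨u, hu⟩ := exists_conv ζ
  obtain ⟨N, hN⟩ := h.forall hd hδ0 hδ hs ht
  obtain ⟨M, hM⟩ := h'.forall hd hδ0 hδ ht hu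
  refine ⟨s, u, hs, hu, max N M, fun i hi j hj => ?_⟩
  have := hyp_le hδ (hN i (le_trans (le_max_left _ _) hi) (max N M) (le_max_left _ _))
      (hM (max N M) (le_max_right _ _) j (le_trans (le_max_right _ _) hj))
  linarith

lemma eq_of_near {d : α → α → ℝ} (hd : PMet d) {δ : ℝ} (hδ0 : 0 ≤ δ) (hδ : DeltaHypD d δ) {w : α}
    {ξ η : BdryD d w} (h : ∀ r : ℝ, 0 ≤ r → Near d w r ξ η) : ξ = η := by
  obtain ⟨s, hs⟩ := exists_conv ξ
  obtain ⟨t, ht⟩ := exists_conv η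
  obtain ⟨h1, e1⟩ := id hs
  obtain ⟨h2, e2⟩ := id ht
  rw [← e1, ← e2]
  apply Quot.sound
  rw [rel_iff]
  intro r
  obtain ⟨N, hN⟩ := (h (max 0 (r + 2 * δ)) (le_max_left _ _)).forall hd hδ0 hδ hs ht
  refine ⟨N, fun i hi j hj => ?_⟩
  have := hN i hi j hj
  have := le_max_right 0 (r + 2 * δ)
  linarith

lemma near_of_lt_bgp {d : α → α → ℝ} {w : α} {ξ η : BdryD d w} {r : ℝ}
    (h : ENNReal.ofReal r < bgpD d w ξ η) : Near d w r ξ η := by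
  unfold bgpD at h
  obtain ⟨s, h⟩ := lt_iSup_iff.1 h
  obtain ⟨t, h⟩ := lt_iSup_iff.1 h
  have h := eventually_lt_of_lt_liminf h
  obtain ⟨N, hN⟩ := (event2_iff
    (fun i j => ENNReal.ofReal r < ENNReal.ofReal (gpD d w (s.1 i) (t.1 j)))).1 h
  refine ⟨s.1, t.1, s.2, t.2, N, fun i hi j hj => ?_⟩
  exact (ENNReal.ofReal_lt_ofReal_iff'.1 (hN i hi j hj)).1.le

lemma near_of_vdist {d : α → α → ℝ} {w : α} {ξ η : BdryD d w} {r : ℝ} (hr : 0 ≤ r)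
    (h : vdistD d w ξ η < Real.exp (-r)) : Near d w r ξ η := by
  unfold vdistD at h
  split_ifs at h with he
  · subst he; exact near_refl r ξ
  · rw [Real.exp_lt_exp] at h
    have h : r < (bgpD d w ξ η).toReal := by linarith
    apply near_of_lt_bgp
    have htop : bgpD d w ξ η ≠ ⊤ := by
      intro e; rw [e] at h; simp at h; linarith
    exact (ENNReal.ofReal_lt_iff_lt_toReal hr htop).2 h

lemma vdist_le_of_near {d : α → α → ℝ} (hd : PMet d) {δ : ℝ} (hδ0 : 0 ≤ δ) (hδ : DeltaHypD d δ)
    {w : α} {ξ η : BdryD d w} {r : ℝ} (h : Near d w r ξ η) :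
    vdistD d w ξ η ≤ Real.exp (-r) := by
  unfold vdistD
  split_ifs with he
  · exact (Real.exp_pos _).le
  · rw [Real.exp_le_exp, neg_le_neg_iff]
    have htop : bgpD d w ξ η ≠ ⊤ := by
      intro e
      apply he
      apply eq_of_near hd hδ0 hδ
      intro r _
      apply near_of_lt_bgp
      rw [e]; exact ENNReal.ofReal_lt_top
    rw [← ENNReal.ofReal_le_iff_le_toReal htop]
    obtain ⟨s, t, hs, ht, N, hN⟩ := h
    unfold bgpD
    refine le_iSup_of_le ⟨s, hs⟩ (le_iSup_of_le ⟨t, ht⟩ ?_)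
    apply le_liminf_of_le
    · isBoundedDefault
    · exact (event2_iff
        (fun i j => ENNReal.ofReal r ≤ ENNReal.ofReal (gpD d w (s i) (t j)))).2
        ⟨N, fun i hi j hj => ENNReal.ofReal_le_ofReal (hN i hi j hj)⟩

lemma vdist_nonneg (d : α → α → ℝ) (w : α) (ξ η : BdryD d w) : 0 ≤ vdistD d w ξ η := by
  unfold vdistD
  split_ifs
  · exact le_rfl
  · exact (Real.exp_pos _).le

lemma vdist_le_one (d : α → α → ℝ) (w : α) (ξ η : BdryD d w) : vdistD d w ξ η ≤ 1 := by
  unfold vdistD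
  split_ifs
  · exact zero_le_one
  · rw [Real.exp_le_one_iff]
    have : 0 ≤ (bgpD d w ξ η).toReal := ENNReal.toReal_nonneg
    linarith

lemma inf_le_pt {X Y : Type*} (f : X → Y → ℝ) (h0 : ∀ a b, 0 ≤ f a b)
    (a : X) {B : Set Y} {b : Y} (hb : b ∈ B) : sInf {t | ∃ b ∈ B, t = f a b} ≤ f a b := by
  apply csInf_le
  · refine ⟨0, ?_⟩
    rintro _ ⟨b, -, rfl⟩
    exact h0 a b
  · exact ⟨b, hb, rfl⟩

lemma inf_le_one {X Y : Type*} (f : X → Y → ℝ) (h0 : ∀ a b, 0 ≤ f a b) (h1 : ∀ a b, f a b ≤ 1)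
    (a : X) (B : Set Y) : sInf {t | ∃ b ∈ B, t = f a b} ≤ 1 := by
  rcases B.eq_empty_or_nonempty with rfl | ⟨b, hb⟩
  · simp
  · exact (inf_le_pt f h0 a hb).trans (h1 a b)

lemma exists_of_supinf_lt {X Y : Type*} (f : X → Y → ℝ) (h0 : ∀ a b, 0 ≤ f a b)
    (h1 : ∀ a b, f a b ≤ 1) (A : Set X) {B : Set Y} (hB : B.Nonempty) {ε : ℝ}
    (h : sSup {r | ∃ a ∈ A, r = sInf {t | ∃ b ∈ B, t = f a b}} < ε) {a : X} (ha : a ∈ A) :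
    ∃ b ∈ B, f a b < ε := by
  have h2 : sInf {t | ∃ b ∈ B, t = f a b} < ε := by
    refine lt_of_le_of_lt ?_ h
    apply le_csSup
    · refine ⟨1, ?_⟩
      rintro _ ⟨a, -, rfl⟩
      exact inf_le_one f h0 h1 a B
    · exact ⟨a, ha, rfl⟩
  have hne : {t | ∃ b ∈ B, t = f a b}.Nonempty := by
    obtain ⟨b, hb⟩ := hB
    exact ⟨_, b, hb, rfl⟩
  obtain ⟨_, ⟨b, hb, rfl⟩, hlt⟩ := exists_lt_of_csInf_lt hne h2
  exact ⟨b, hb, hlt⟩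

lemma supinf_le {X Y : Type*} (f : X → Y → ℝ) (h0 : ∀ a b, 0 ≤ f a b)
    (A : Set X) (B : Set Y) {ε : ℝ} (hε : 0 ≤ ε)
    (h : ∀ a ∈ A, ∃ b ∈ B, f a b ≤ ε) :
    sSup {r | ∃ a ∈ A, r = sInf {t | ∃ b ∈ B, t = f a b}} ≤ ε := by
  apply Real.sSup_le _ hε
  rintro _ ⟨a, ha, rfl⟩
  obtain ⟨b, hb, hab⟩ := h a ha
  exact (inf_le_pt f h0 a hb).trans hab

lemma vH_lt {d : α → α → ℝ} {w : α} {A B : Set (BdryD d w)} (hB : B.Nonempty) (hA : A.Nonempty)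
    {r : ℝ} (hr : 0 ≤ r) (h : vHdistD d w A B < Real.exp (-r)) :
    (∀ a ∈ A, ∃ b ∈ B, Near d w r a b) ∧ (∀ b ∈ B, ∃ a ∈ A, Near d w r a b) := by
  unfold vHdistD at h
  rw [max_lt_iff] at h
  constructor
  · intro a ha
    obtain ⟨b, hb, hab⟩ := exists_of_supinf_lt (vdistD d w) (vdist_nonneg d w) (vdist_le_one d w)
      A hB h.1 ha
    exact ⟨b, hb, near_of_vdist hr hab⟩
  · intro b hb
    obtain ⟨a, ha, hab⟩ := exists_of_supinf_lt (fun b a => vdistD d w a b)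
      (fun b a => vdist_nonneg d w a b) (fun b a => vdist_le_one d w a b) B hA h.2 hb
    exact ⟨a, ha, near_of_vdist hr hab⟩

lemma vH_le {d : α → α → ℝ} (hd : PMet d) {δ : ℝ} (hδ0 : 0 ≤ δ) (hδ : DeltaHypD d δ) {w : α}
    {A B : Set (BdryD d w)} {r : ℝ}
    (h1 : ∀ a ∈ A, ∃ b ∈ B, Near d w r a b) (h2 : ∀ b ∈ B, ∃ a ∈ A, Near d w r a b) :
    vHdistD d w A B ≤ Real.exp (-r) := by
  unfold vHdistD
  apply max_le
  · apply supinf_le (vdistD d w) (vdist_nonneg d w) A B (Real.exp_pos _).le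
    intro a ha
    obtain ⟨b, hb, hab⟩ := h1 a ha
    exact ⟨b, hb, vdist_le_of_near hd hδ0 hδ hab⟩
  · apply supinf_le (fun b a => vdistD d w a b) (fun b a => vdist_nonneg d w a b) B A
      (Real.exp_pos _).le
    intro a ha
    obtain ⟨b, hb, hab⟩ := h2 a ha
    exact ⟨b, hb, vdist_le_of_near hd hδ0 hδ hab⟩

/-- Compactness of the boundary of a proper geodesic space, along an ultrafilter. -/
lemma ultralim_exists {d : α → α → ℝ} (hd : PMet d) {δ : ℝ} (hδ0 : 0 ≤ δ) (hδ : DeltaHypD d δ)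
    {w : α} (hfin : ∀ r : ℝ, {x | d w x ≤ r}.Finite)
    (hgeo : ∀ (z : α) (n : ℕ), (n : ℝ) ≤ d w z → ∃ y, d w y = n ∧ d y z = d w z - n)
    (𝒰 : Ultrafilter ℕ) (x : ℕ → BdryD d w) :
    ∃ ξ, ∀ r : ℝ, ∀ᶠ i in (𝒰 : Filter ℕ), Near d w r ξ (x i) := by
  choose s hs using fun i => exists_conv (x i)
  have key : ∀ n i : ℕ, ∃ y, d w y = n ∧ ∃ N, ∀ k ≥ N, (n : ℝ) - δ ≤ gpD d w y (s i k) := by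
    intro n i
    obtain ⟨h, -⟩ := hs i
    obtain ⟨N, hN⟩ := gromov_iff.1 h n
    have hNN := hN N le_rfl N le_rfl
    have : (n : ℝ) ≤ d w (s i N) := by
      unfold gpD at hNN
      rw [hd.self] at hNN; linarith
    obtain ⟨y, hy1, hy2⟩ := hgeo _ n this
    refine ⟨y, hy1, N, fun k hk => ?_⟩
    refine hyp_le hδ (y := s i N) ?_ (hN N le_rfl k hk)
    unfold gpD; rw [hy1, hy2]; linarith
  choose y hy1 hy2 using key
  have hconst : ∀ n, ∃ z, ∀ᶠ i in (𝒰 : Filter ℕ), y n i = z := by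
    intro n
    have hf := hfin n
    have : ∀ᶠ i in (𝒰 : Filter ℕ), ∃ z ∈ {x | d w x ≤ n}, y n i = z :=
      Eventually.of_forall (fun i => ⟨y n i, (hy1 n i).le, rfl⟩)
    rw [Ultrafilter.eventually_exists_mem_iff hf] at this
    obtain ⟨z, -, hz⟩ := this
    exact ⟨z, hz⟩
  choose z hz using hconst
  have hzz : ∀ n m, ((min n m : ℕ) : ℝ) - 2 * δ ≤ gpD d w (z n) (z m) := by
    intro n m
    obtain ⟨i, h1, h2⟩ := ((hz n).and (hz m)).exists
    obtain ⟨N, hN⟩ := hy2 n i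
    obtain ⟨M, hM⟩ := hy2 m i
    rw [h1] at hN; rw [h2] at hM
    have a1 := hN (max N M) (le_max_left _ _)
    have a2 := hM (max N M) (le_max_right _ _)
    rw [hd.gp_symm] at a2
    have b1 : ((min n m : ℕ) : ℝ) ≤ n := by exact_mod_cast min_le_left n m
    have b2 : ((min n m : ℕ) : ℝ) ≤ m := by exact_mod_cast min_le_right n m
    have := hyp_le hδ (show ((min n m : ℕ) : ℝ) - δ ≤ _ by linarith)
      (show ((min n m : ℕ) : ℝ) - δ ≤ _ by linarith) (w := w) (x := z n) (y := s i (max N M)) (z := z m)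
    linarith
  have hzG : GromovSeqD d w z := by
    rw [gromov_iff]
    intro r
    obtain ⟨N, hN⟩ := exists_nat_ge (r + 2 * δ)
    refine ⟨N, fun i hi j hj => ?_⟩
    have : (N : ℝ) ≤ ((min i j : ℕ) : ℝ) := by exact_mod_cast le_min hi hj
    linarith [hzz i j]
  refine ⟨Quot.mk _ ⟨z, hzG⟩, fun r => ?_⟩
  obtain ⟨n, hn⟩ := exists_nat_ge (r + 3 * δ)
  filter_upwards [hz n] with i hi
  obtain ⟨N, hN⟩ := hy2 n i
  rw [hi] at hN
  refine ⟨z, s i, ⟨hzG, rfl⟩, hs i, max n N, fun k hk l hl => ?_⟩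
  have a1 := hzz k n
  have : min k n = n := min_eq_right ((le_max_left _ _).trans hk)
  rw [this] at a1
  have a2 := hN l ((le_max_right _ _).trans hl)
  have := hyp_le hδ a1 (show (n : ℝ) - 2 * δ ≤ _ by linarith)
  linarith

/-- Hausdorff compactness along an ultrafilter. -/
lemma ultralim_sets {d : α → α → ℝ} (hd : PMet d) {δ : ℝ} (hδ0 : 0 ≤ δ) (hδ : DeltaHypD d δ)
    {w : α} (hfin : ∀ r : ℝ, {x | d w x ≤ r}.Finite)
    (hgeo : ∀ (z : α) (n : ℕ), (n : ℝ) ≤ d w z → ∃ y, d w y = n ∧ d y z = d w z - n)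
    (𝒰 : Ultrafilter ℕ) (L : ℕ → Set (BdryD d w)) (r₁ : ℝ)
    (hL : ∀ n, ∃ ξ ∈ L n, ∃ η ∈ L n, ¬ Near d w r₁ ξ η) :
    ∃ K, VClosed d w K ∧ K.Nontrivial ∧
      ∀ ε > (0 : ℝ), ∀ᶠ n in (𝒰 : Filter ℕ), vHdistD d w (L n) K < ε := by
  set K : Set (BdryD d w) :=
    {ξ | ∀ r : ℝ, ∀ᶠ n in (𝒰 : Filter ℕ), ∃ η ∈ L n, Near d w r ξ η} with hK
  have hclosed : ∀ ξ, (∀ r : ℝ, 0 ≤ r → ∃ η ∈ K, Near d w r ξ η) → ξ ∈ K := by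
    intro ξ h r
    obtain ⟨η, hη, hn⟩ := h (max 0 (r + 3 * δ)) (le_max_left _ _)
    filter_upwards [hη (r + 3 * δ)] with n hn'
    obtain ⟨ζ, hζ, hnz⟩ := hn'
    refine ⟨ζ, hζ, ?_⟩
    exact ((hn.mono (le_max_right _ _)).trans hd hδ0 hδ hnz).mono (by linarith)
  refine ⟨K, ?_, ?_, ?_⟩
  · intro ξ h
    apply hclosed
    intro r hr
    obtain ⟨η, hη, hv⟩ := h _ (Real.exp_pos (-r))
    exact ⟨η, hη, near_of_vdist hr hv⟩
  · choose ξ hξ η hη hne using hL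
    obtain ⟨a, ha⟩ := ultralim_exists hd hδ0 hδ hfin hgeo 𝒰 ξ
    obtain ⟨b, hb⟩ := ultralim_exists hd hδ0 hδ hfin hgeo 𝒰 η
    refine ⟨a, ?_, b, ?_, ?_⟩
    · intro r
      filter_upwards [ha r] with n hn using ⟨ξ n, hξ n, hn⟩
    · intro r
      filter_upwards [hb r] with n hn using ⟨η n, hη n, hn⟩
    · intro hab
      obtain ⟨n, h1, h2⟩ := ((ha (r₁ + 3 * δ)).and (hb (r₁ + 3 * δ))).exists
      rw [← hab] at h2
      exact hne n (((h1.symm hd).trans hd hδ0 hδ h2).mono (by linarith))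
  · intro ε hε
    obtain ⟨r, hr⟩ : ∃ r : ℝ, Real.exp (-r) < ε := by
      have := (Real.tendsto_exp_neg_atTop_nhds_zero).eventually (gt_mem_nhds hε)
      exact this.exists
    have h1 : ∀ᶠ n in (𝒰 : Filter ℕ), ∀ a ∈ L n, ∃ b ∈ K, Near d w r a b := by
      by_contra hcon
      rw [← Ultrafilter.eventually_not] at hcon
      have : ∀ n, ∃ x : BdryD d w, (¬ ∀ a ∈ L n, ∃ b ∈ K, Near d w r a b) →
          x ∈ L n ∧ ∀ b ∈ K, ¬ Near d w r x b := by
        intro n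
        by_cases hc : ∀ a ∈ L n, ∃ b ∈ K, Near d w r a b
        · obtain ⟨ξ, -⟩ := hL n
          exact ⟨ξ, fun h => (h hc).elim⟩
        · push Not at hc
          obtain ⟨a, ha, hb⟩ := hc
          exact ⟨a, fun _ => ⟨ha, hb⟩⟩
      choose x hx using this
      obtain ⟨a, ha⟩ := ultralim_exists hd hδ0 hδ hfin hgeo 𝒰 x
      have haK : a ∈ K := by
        intro r'
        filter_upwards [ha r', hcon] with n hn hc
        exact ⟨x n, (hx n hc).1, hn⟩
      obtain ⟨n, hn, hc⟩ := ((ha r).and hcon).exists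
      exact (hx n hc).2 a haK (hn.symm hd)
    have h2 : ∀ᶠ n in (𝒰 : Filter ℕ), ∀ b ∈ K, ∃ a ∈ L n, Near d w r a b := by
      by_contra hcon
      rw [← Ultrafilter.eventually_not] at hcon
      have : ∀ n, ∃ x : BdryD d w, (¬ ∀ b ∈ K, ∃ a ∈ L n, Near d w r a b) →
          x ∈ K ∧ ∀ a ∈ L n, ¬ Near d w r a x := by
        intro n
        by_cases hc : ∀ b ∈ K, ∃ a ∈ L n, Near d w r a b
        · obtain ⟨ξ, -⟩ := hL n
          exact ⟨ξ, fun h => (h hc).elim⟩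
        · push Not at hc
          obtain ⟨a, ha, hb⟩ := hc
          exact ⟨a, fun _ => ⟨ha, hb⟩⟩
      choose x hx using this
      obtain ⟨a, ha⟩ := ultralim_exists hd hδ0 hδ hfin hgeo 𝒰 x
      have haK : a ∈ K := by
        apply hclosed
        intro r' _
        obtain ⟨n, hn, hc⟩ := ((ha r').and hcon).exists
        exact ⟨x n, (hx n hc).1, hn⟩
      obtain ⟨n, ⟨hn, hc⟩, ⟨b, hb, hab⟩⟩ :=
        (((ha (r + 3 * δ)).and hcon).and (haK (r + 3 * δ))).exists
      exact (hx n hc).2 b hb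
        ((((hab.symm hd).trans hd hδ0 hδ hn)).mono (by linarith))
    filter_upwards [h1, h2] with n a1 a2
    exact (vH_le hd hδ0 hδ a1 a2).trans_lt hr

/-- Points far along a geodesic: the Gromov product bound for quasi-lines. -/
lemma gp_far {d : α → α → ℝ} (hd : PMet d) {δ : ℝ} (hδ : DeltaHypD d δ) {p h k u : α} {r n : ℝ}
    (hp : gpD d p h k = 0) (hr : gpD d h u k ≤ r) (hn : r + δ < n) (hph : n ≤ d p h) :
    n - r - δ ≤ gpD d p h u := by
  have h1 := hδ h u p k
  have h2 : gpD d h p k = d p h := by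
    unfold gpD at hp ⊢
    rw [hd.symm h p, hd.symm h k] at *
    rw [hd.symm k h] at *
    linarith
  have h3 : gpD d h u p ≤ r + δ := by
    rcases min_le_iff.1 (le_refl (min (gpD d h u p) (gpD d h p k))) with h4 | h4 <;> linarith
  unfold gpD at h3 ⊢
  rw [hd.symm h p, hd.symm u p] at h3
  linarith

/-- A point on a geodesic close to the base point. -/
lemma geod_close {d : α → α → ℝ} (hd : PMet d) {δ : ℝ} (hδ : DeltaHypD d δ) {c : ℕ → α} {m : ℕ}
    (hc : DiscGeodD d c m) (w : α) :
    ∃ i ≤ m, d w (c i) ≤ gpD d w (c 0) (c m) + 2 * δ + 2 := by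
  have hm : d (c 0) (c m) = m := by
    rw [hc 0 (Nat.zero_le _) m le_rfl]; simp
  have g0 : 0 ≤ gpD d (c 0) w (c m) := by
    unfold gpD; rw [hd.symm w (c m), hd.symm (c 0) w]
    have := hd.tri w (c 0) (c m)
    have := hd.tri (c 0) w (c m)
    have := hd.tri (c m) (c 0) w
    rw [hd.symm (c m) (c 0), hd.symm (c 0) w] at this
    linarith
  have g1 : gpD d (c 0) w (c m) ≤ m := by
    unfold gpD
    have := hd.tri (c 0) (c m) w
    rw [hd.symm (c m) w] at this
    linarith
  have hfl := Nat.floor_le g0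
  have hfl2 := Nat.lt_floor_add_one (gpD d (c 0) w (c m))
  set i := ⌊gpD d (c 0) w (c m)⌋₊ with hi
  have him : i ≤ m := by exact_mod_cast hfl.trans g1
  refine ⟨i, him, ?_⟩
  have him' : (i : ℝ) ≤ m := by exact_mod_cast him
  have e1 : d (c 0) (c i) = i := by
    rw [hc 0 (Nat.zero_le _) i him]; simp
  have e2 : d (c i) (c m) = m - i := by
    rw [hc i him m le_rfl, abs_sub_comm, abs_of_nonneg]; linarith
  have h1 := hδ (c 0) w (c m) (c i)
  have h2 : gpD d (c 0) (c m) (c i) = i := by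
    unfold gpD; rw [hd.symm (c m) (c i), e1, e2, hm]; ring
  rw [h2, min_eq_right hfl] at h1
  unfold gpD at *
  rw [hm, e1, hd.symm (c 0) w] at *
  linarith

end Helpers

section Word
variable {G : Type*} [Group G]

/-- `l` is a word in the generators. -/
def IsWord (S : Set G) (l : List G) : Prop := ∀ x ∈ l, x ∈ S ∨ x⁻¹ ∈ S

lemma exists_word {S : Set G} (hS : Subgroup.closure S = ⊤) (g : G) :
    ∃ l, IsWord S l ∧ l.prod = g := by
  have hg : g ∈ (Subgroup.closure S).toSubmonoid := by
    rw [hS]; exact Subgroup.mem_top g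
  rw [Subgroup.closure_toSubmonoid] at hg
  obtain ⟨l, hl, hp⟩ := Submonoid.exists_list_of_mem_closure hg
  exact ⟨l, fun x hx => hl x hx, hp⟩

lemma wdist_le {S : Set G} {g h : G} {l : List G} (hl : IsWord S l) (hp : l.prod = g⁻¹ * h) :
    wdist S g h ≤ l.length := by
  unfold wdist
  apply csInf_le
  · refine ⟨0, ?_⟩
    rintro _ ⟨l, -, -, rfl⟩
    positivity
  · exact ⟨l, hl, hp, rfl⟩

lemma wdist_attained {S : Set G} (hS : Subgroup.closure S = ⊤) (g h : G) :
    ∃ l, IsWord S l ∧ l.prod = g⁻¹ * h ∧ wdist S g h = l.length := by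
  classical
  have hex : ∃ n, ∃ l, IsWord S l ∧ l.prod = g⁻¹ * h ∧ l.length = n := by
    obtain ⟨l, h1, h2⟩ := exists_word hS (g⁻¹ * h)
    exact ⟨_, l, h1, h2, rfl⟩
  obtain ⟨l, h1, h2, h3⟩ := Nat.find_spec hex
  refine ⟨l, h1, h2, le_antisymm (wdist_le h1 h2) ?_⟩
  unfold wdist
  apply le_csInf
  · exact ⟨_, l, h1, h2, rfl⟩
  · rintro _ ⟨l', a, b, rfl⟩
    rw [h3]
    exact_mod_cast Nat.find_min' hex ⟨l', a, b, rfl⟩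

lemma wdist_left (S : Set G) (a g h : G) : wdist S (a * g) (a * h) = wdist S g h := by
  unfold wdist
  have : (a * g)⁻¹ * (a * h) = g⁻¹ * h := by group
  rw [this]

lemma IsWord.append {S : Set G} {l m : List G} (hl : IsWord S l) (hm : IsWord S m) :
    IsWord S (l ++ m) := by
  intro x hx
  rcases List.mem_append.1 hx with h | h
  · exact hl x h
  · exact hm x h

lemma wdist_nonneg (S : Set G) (g h : G) : 0 ≤ wdist S g h := by
  unfold wdist
  apply Real.sInf_nonneg
  rintro _ ⟨l, -, -, rfl⟩
  positivity

lemma wdist_symm_le {S : Set G} (hS : Subgroup.closure S = ⊤) (g h : G) :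
    wdist S g h ≤ wdist S h g := by
  obtain ⟨l, h1, h2, h3⟩ := wdist_attained hS h g
  rw [h3]
  have := wdist_le (S := S) (g := g) (h := h) (l := (l.map (fun x => x⁻¹)).reverse) ?_ ?_
  · simpa using this
  · intro x hx
    simp only [List.mem_reverse, List.mem_map] at hx
    obtain ⟨y, hy, rfl⟩ := hx
    rw [inv_inv]
    exact (h1 y hy).symm
  · rw [← List.prod_inv_reverse, h2]; group

lemma pmet_wdist {S : Set G} (hS : Subgroup.closure S = ⊤) : PMet (wdist S) where
  self x := by
    apply le_antisymm _ (wdist_nonneg S x x)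
    have := wdist_le (S := S) (g := x) (h := x) (l := []) (by intro x hx; simp at hx) (by simp)
    simpa using this
  symm x y := le_antisymm (wdist_symm_le hS x y) (wdist_symm_le hS y x)
  tri x y z := by
    obtain ⟨l, h1, h2, h3⟩ := wdist_attained hS x y
    obtain ⟨m, k1, k2, k3⟩ := wdist_attained hS y z
    rw [h3, k3]
    have := wdist_le (S := S) (g := x) (h := z) (h1.append k1)
      (by rw [List.prod_append, h2, k2]; group)
    simpa using this
  nonneg := wdist_nonneg S

lemma wball_finite {S : Set G} (hf : S.Finite) (hS : Subgroup.closure S = ⊤) (r : ℝ) :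
    {x | wdist S 1 x ≤ r}.Finite := by
  have hT : (S ∪ {x | x⁻¹ ∈ S}).Finite := by
    apply hf.union
    exact hf.preimage (f := fun x : G => x⁻¹) (inv_injective.injOn)
  have key : ∀ n : ℕ, {x | ∃ l : List G, IsWord S l ∧ l.prod = x ∧ l.length = n}.Finite := by
    intro n
    induction n with
    | zero =>
      apply (Set.finite_singleton (1 : G)).subset
      rintro x ⟨l, -, rfl, h⟩
      rw [List.length_eq_zero_iff] at h
      simp [h]
    | succ n ih =>
      apply (hT.image2 (fun a b => a * b) ih).subset
      rintro x ⟨l, hl, rfl, h⟩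
      cases l with
      | nil => simp at h
      | cons a l =>
        refine ⟨a, hl a (by simp), l.prod, ⟨l, fun x hx => hl x (by simp [hx]), rfl, ?_⟩, by simp⟩
        simpa using h
  apply ((Set.finite_Iic ⌊r⌋₊).biUnion (fun n _ => key n)).subset
  intro x hx
  obtain ⟨l, h1, h2, h3⟩ := wdist_attained hS 1 x
  simp only [mem_ofPred_eq] at hx
  rw [h3] at hx
  simp only [mem_iUnion]
  exact ⟨l.length, Nat.le_floor hx, l, h1, by simpa using h2, rfl⟩

lemma exists_geod {S : Set G} (hS : Subgroup.closure S = ⊤) (x y : G) :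
    ∃ (c : ℕ → G) (m : ℕ), DiscGeodD (wdist S) c m ∧ c 0 = x ∧ c m = y ∧ wdist S x y = m := by
  have hd := pmet_wdist hS
  obtain ⟨l, h1, h2, h3⟩ := wdist_attained hS x y
  set c : ℕ → G := fun i => x * (l.take i).prod with hcdef
  have c0 : c 0 = x := by simp [hcdef]
  have cm : c l.length = y := by simp [hcdef, h2]
  have hle : ∀ i j, i ≤ j → j ≤ l.length → wdist S (c i) (c j) ≤ (j : ℝ) - i := by
    intro i j hij hj
    have e : l.take j = l.take i ++ (l.take j).drop i := by
      conv_lhs => rw [← List.take_append_drop i (l.take j)]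
      rw [List.take_take, min_eq_left hij]
    have := wdist_le (S := S) (g := c i) (h := c j) (l := (l.take j).drop i)
      (fun x hx => h1 x (List.mem_of_mem_take (List.mem_of_mem_drop hx)))
      (by
        simp only [hcdef]
        rw [mul_inv_rev, mul_assoc, inv_mul_cancel_left, eq_inv_mul_iff_mul_eq, ← List.prod_append,
          ← e])
    rw [List.length_drop, List.length_take, min_eq_left hj, Nat.cast_sub hij] at this
    exact this
  have heq : ∀ i j, i ≤ j → j ≤ l.length → wdist S (c i) (c j) = (j : ℝ) - i := by
    intro i j hij hj
    apply le_antisymm (hle i j hij hj)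
    have a1 := hle 0 i (Nat.zero_le _) (hij.trans hj)
    have a2 := hle j l.length hj le_rfl
    rw [c0] at a1; rw [cm] at a2
    have t1 := hd.tri x (c i) y
    have t2 := hd.tri (c i) (c j) y
    rw [h3] at t1
    push_cast at a1
    linarith
  refine ⟨c, l.length, ?_, c0, cm, h3⟩
  intro i hi j hj
  rcases le_total i j with h | h
  · rw [heq i j h hj, abs_sub_comm, abs_of_nonneg]
    have : (i : ℝ) ≤ j := by exact_mod_cast h
    linarith
  · rw [hd.symm, heq j i h hi, abs_of_nonneg]
    have : (j : ℝ) ≤ i := by exact_mod_cast h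
    linarith

lemma geo_pt {S : Set G} (hS : Subgroup.closure S = ⊤) (w z : G) (n : ℕ)
    (hn : (n : ℝ) ≤ wdist S w z) : ∃ y, wdist S w y = n ∧ wdist S y z = wdist S w z - n := by
  obtain ⟨c, m, hc, h0, hm, hw⟩ := exists_geod hS w z
  rw [hw] at hn ⊢
  have hnm : n ≤ m := by exact_mod_cast hn
  refine ⟨c n, ?_, ?_⟩
  · rw [← h0, hc 0 (Nat.zero_le _) n hnm]; simp
  · rw [← hm, hc n hnm m le_rfl, abs_sub_comm, abs_of_nonneg]; linarith

lemma gp_left (S : Set G) (a w x y : G) :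
    gpD (wdist S) (a * w) (a * x) (a * y) = gpD (wdist S) w x y := by
  unfold gpD
  simp only [wdist_left]

/-- Changing the base point. -/
lemma gp_base {d : α → α → ℝ} (hd : PMet d) (w w' x y : α) :
    gpD d w x y - d w w' ≤ gpD d w' x y := by
  unfold gpD
  linarith [hd.tri w w' x, hd.tri w w' y]

lemma gromov_left {S : Set G} (hS : Subgroup.closure S = ⊤) (a : G) {s : ℕ → G}
    (hs : GromovSeqD (wdist S) 1 s) : GromovSeqD (wdist S) 1 (fun i => a * s i) := by
  rw [gromov_iff] at hs ⊢
  intro r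
  obtain ⟨N, hN⟩ := hs (r + wdist S 1 a⁻¹)
  refine ⟨N, fun i hi j hj => ?_⟩
  have h1 := gp_base (pmet_wdist hS) 1 a⁻¹ (s i) (s j)
  have h2 := gp_left S a a⁻¹ (s i) (s j)
  rw [mul_inv_cancel] at h2
  rw [h2]
  linarith [hN i hi j hj]

lemma pdist_le {d : α → α → ℝ} (hd : PMet d) {x a : α} {A : Set α} (ha : a ∈ A) :
    pdistD d x A ≤ d x a := by
  unfold pdistD
  apply csInf_le
  · refine ⟨0, ?_⟩
    rintro _ ⟨b, -, rfl⟩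
    exact hd.nonneg x b
  · exact ⟨a, ha, rfl⟩

lemma exists_of_pdist_lt {d : α → α → ℝ} {x : α} {A : Set α} (hA : A.Nonempty) {r : ℝ}
    (h : pdistD d x A < r) : ∃ a ∈ A, d x a < r := by
  unfold pdistD at h
  have hne : {r | ∃ a ∈ A, r = d x a}.Nonempty := by
    obtain ⟨a, ha⟩ := hA
    exact ⟨_, a, ha, rfl⟩
  obtain ⟨_, ⟨a, ha, rfl⟩, hlt⟩ := exists_lt_of_csInf_lt hne h
  exact ⟨a, ha, hlt⟩

lemma cosetLimitSet_nonempty {S : Set G} (hS : Subgroup.closure S = ⊤) {H : Subgroup G}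
    (hΛ : (limitSetD (wdist S) (1 : G) (H : Set G)).Nonempty) (g : G) :
    (cosetLimitSet S H g).Nonempty := by
  obtain ⟨ξ, s, hs, hG, -⟩ := hΛ
  refine ⟨Quot.mk _ ⟨_, gromov_left hS g hG⟩, fun i => g * s i, fun i => ?_, _, rfl⟩
  simpa [cosetSet] using hs i

/-- forward direction: cosets whose limit sets are close to `K` meet a fixed ball. -/
lemma coset_meets {S : Set G} (hS : Subgroup.closure S = ⊤) {δ : ℝ}
    (hδ : DeltaHypD (wdist S) δ) {H : Subgroup G} {C : ℝ}
    (hQC : QCSetD (wdist S) C (H : Set G)) {g : G} {a b : BdryD (wdist S) (1 : G)} {r : ℝ}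
    (ha : a ∈ cosetLimitSet S H g) (hb : b ∈ cosetLimitSet S H g)
    (hab : ¬ Near (wdist S) 1 r a b) :
    ∃ x ∈ cosetSet H g, wdist S 1 x ≤ r + 2 * δ + 3 + C := by
  have hd := pmet_wdist hS
  obtain ⟨s, hs, hsa⟩ := ha
  obtain ⟨t, ht, htb⟩ := hb
  have : ∃ i j, gpD (wdist S) 1 (s i) (t j) < r := by
    by_contra hcon
    push Not at hcon
    exact hab ⟨s, t, hsa, htb, 0, fun i _ j _ => hcon i j⟩
  obtain ⟨i, j, hij⟩ := this
  obtain ⟨c, m, hc, h0, hm, -⟩ := exists_geod hS (s i) (t j)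
  obtain ⟨k, hk, hck⟩ := geod_close hd hδ hc 1
  rw [h0, hm] at hck
  have hq := hQC (fun n => g⁻¹ * c n) m
    (fun i hi j hj => by
      show wdist S (g⁻¹ * c i) (g⁻¹ * c j) = _
      rw [wdist_left]; exact hc i hi j hj)
    (by show g⁻¹ * c 0 ∈ H; rw [h0]; exact hs i) (by show g⁻¹ * c m ∈ H; rw [hm]; exact ht j) k hk
  obtain ⟨x, hx, hlt⟩ := exists_of_pdist_lt (r := C + 1) ⟨1, H.one_mem⟩ (by linarith)
  refine ⟨g * x, by simpa [cosetSet] using hx, ?_⟩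
  have h1 := hd.tri 1 (c k) (g * x)
  have h2 := wdist_left S g (g⁻¹ * c k) x
  rw [mul_inv_cancel_left] at h2
  rw [← h2] at hlt
  linarith

/-- From every point `h` of `H` and in every direction `k` there is a limit point of `H`
which is not in that direction. -/
lemma exists_tail {S : Set G} (hS : Subgroup.closure S = ⊤) {δ : ℝ} (hδ0 : 0 ≤ δ)
    (hδ : DeltaHypD (wdist S) δ) {H : Subgroup G}
    (hΛ : (limitSetD (wdist S) (1 : G) (H : Set G)).Nontrivial) :
    ∃ r : ℝ, ∀ h ∈ H, ∀ k : G, ∃ u : ℕ → G, (∀ n, u n ∈ H) ∧ GromovSeqD (wdist S) 1 u ∧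
      ∃ N, ∀ i ≥ N, gpD (wdist S) h (u i) k ≤ r := by
  have hd := pmet_wdist hS
  obtain ⟨ξ, ⟨s, hsH, hs⟩, η, ⟨t, htH, ht⟩, hne⟩ := hΛ
  obtain ⟨r₀, hr₀⟩ : ∃ r₀ : ℝ, ¬ Near (wdist S) 1 r₀ ξ η := by
    by_contra hcon
    push Not at hcon
    exact hne (eq_of_near hd hδ0 hδ (fun r _ => hcon r))
  obtain ⟨hsG, -⟩ := id hs
  obtain ⟨htG, -⟩ := id ht
  obtain ⟨N₁, hN₁⟩ := gromov_iff.1 hsG (r₀ + 4 * δ + 1)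
  obtain ⟨N₂, hN₂⟩ := gromov_iff.1 htG (r₀ + 4 * δ + 1)
  have e1 : N₁ ≤ max N₁ N₂ := le_max_left _ _
  have e2 : N₂ ≤ max N₁ N₂ := le_max_right _ _
  generalize max N₁ N₂ = N at e1 e2
  have hst : gpD (wdist S) 1 (s N) (t N) < r₀ + 2 * δ := by
    by_contra hcon
    push Not at hcon
    apply hr₀
    refine ⟨s, t, hs, ht, N, fun i hi j hj => ?_⟩
    have a1 := hN₁ i (e1.trans hi) N e1
    have a2 := hN₂ N e2 j (e2.trans hj)
    have b1 := hyp_le hδ (show r₀ + 2 * δ ≤ _ by linarith) hcon (w := 1) (x := s i)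
    have b2 := hyp_le hδ b1 (show r₀ + 2 * δ - δ ≤ _ by linarith) (z := t j)
    linarith
  refine ⟨r₀ + 4 * δ, fun h hh k => ?_⟩
  have aux : ∀ v : ℕ → G, (∀ i ≥ N, r₀ + 4 * δ + 1 ≤ gpD (wdist S) 1 (v N) (v i)) →
      gpD (wdist S) 1 (v N) (h⁻¹ * k) ≤ r₀ + 3 * δ →
      ∀ i ≥ N, gpD (wdist S) h (h * v i) k ≤ r₀ + 4 * δ := by
    intro v hv hvN i hi
    have e := gp_left S h 1 (v i) (h⁻¹ * k)
    rw [mul_one, mul_inv_cancel_left] at e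
    rw [e]
    by_contra hcon
    push Not at hcon
    have a1 := hv i hi
    have := hδ 1 (v N) (v i) (h⁻¹ * k)
    have : r₀ + 4 * δ < min (gpD (wdist S) 1 (v N) (v i)) (gpD (wdist S) 1 (v i) (h⁻¹ * k)) :=
      lt_min (by linarith) hcon
    linarith
  have hmin := hδ 1 (s N) (h⁻¹ * k) (t N)
  have hmin' : min (gpD (wdist S) 1 (s N) (h⁻¹ * k)) (gpD (wdist S) 1 (h⁻¹ * k) (t N))
      ≤ r₀ + 3 * δ := by linarith
  rcases min_le_iff.1 hmin' with hc | hc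
  · exact ⟨fun i => h * s i, fun n => H.mul_mem hh (hsH n), gromov_left hS h hsG, N,
      aux s (fun i hi => hN₁ N e1 i (e1.trans hi)) hc⟩
  · rw [hd.gp_symm] at hc
    exact ⟨fun i => h * t i, fun n => H.mul_mem hh (htH n), gromov_left hS h htG, N,
      aux t (fun i hi => hN₂ N e2 i (e2.trans hi)) hc⟩

/-- backward direction: if `p` is on a geodesic with endpoints in `H`, far from these endpoints,
then the translate `p⁻¹Λ` is visually large. -/
lemma far_pts {S : Set G} (hS : Subgroup.closure S = ⊤) {δ : ℝ} (hδ0 : 0 ≤ δ)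
    (hδ : DeltaHypD (wdist S) δ) {H : Subgroup G}
    (hΛ : (limitSetD (wdist S) (1 : G) (H : Set G)).Nontrivial) :
    ∃ n₀ : ℝ, ∀ h ∈ H, ∀ k ∈ H, ∀ p g : G, gpD (wdist S) p h k = 0 → n₀ ≤ wdist S p h →
      n₀ ≤ wdist S p k → p * g ∈ H →
      ∃ ξ ∈ cosetLimitSet S H g, ∃ η ∈ cosetLimitSet S H g,
        ¬ Near (wdist S) 1 (4 * δ + 1) ξ η := by
  have hd := pmet_wdist hS
  obtain ⟨r, hr⟩ := exists_tail hS hδ0 hδ hΛ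
  refine ⟨r + 5 * δ + 1, fun h hh k hk p g hp hph hpk hpg => ?_⟩
  obtain ⟨u, huH, huG, N, hN⟩ := hr h hh k
  obtain ⟨v, hvH, hvG, M, hM⟩ := hr k hk h
  have main : ∀ i ≥ N, ∀ j ≥ M, gpD (wdist S) p (u i) (v j) ≤ 2 * δ := by
    intro i hi j hj
    have a1 := gp_far hd hδ hp (hN i hi) (by linarith) hph
    have a2 := gp_far hd hδ (by rw [hd.gp_symm]; exact hp) (hM j hj) (by linarith) hpk
    rw [hd.gp_symm] at a2
    have b1 := hδ p h (u i) k
    have b2 := hδ p (u i) (v j) k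
    rw [hp] at b1
    have c1 : gpD (wdist S) p (u i) k ≤ δ := by
      rcases min_choice (gpD (wdist S) p h (u i)) (gpD (wdist S) p (u i) k) with e | e <;>
        rw [e] at b1 <;> linarith
    rcases min_choice (gpD (wdist S) p (u i) (v j)) (gpD (wdist S) p (v j) k) with e | e <;>
        rw [e] at b2 <;> linarith
  have hmem : ∀ x ∈ H, p⁻¹ * x ∈ cosetSet H g := by
    intro x hx
    show g⁻¹ * (p⁻¹ * x) ∈ H
    rw [← mul_assoc, ← mul_inv_rev]
    exact H.mul_mem (H.inv_mem hpg) hx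
  have hu' := gromov_left hS p⁻¹ huG
  have hv' := gromov_left hS p⁻¹ hvG
  refine ⟨Quot.mk _ ⟨_, hu'⟩, ⟨_, fun n => hmem _ (huH n), hu', rfl⟩,
    Quot.mk _ ⟨_, hv'⟩, ⟨_, fun n => hmem _ (hvH n), hv', rfl⟩, fun hnear => ?_⟩
  obtain ⟨A, hA⟩ := hnear.forall hd hδ0 hδ ⟨hu', rfl⟩ ⟨hv', rfl⟩
  have a1 := hA (max A N) (le_max_left _ _) (max A M) (le_max_left _ _)
  have a2 := main (max A N) (le_max_right _ _) (max A M) (le_max_right _ _)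
  have e := gp_left S p⁻¹ p (u (max A N)) (v (max A M))
  rw [inv_mul_cancel] at e
  rw [e] at a1
  linarith

end Word

/-- **Proposition (qc=discrete), Characterization of Quasiconvexity I.**
Let `H` be a subgroup of a hyperbolic group `G` with limit set `Λ` (a subset of
`C_c⁰(∂G)`, i.e. with more than one point), and let `ℒ` be the collection of
translates of `Λ` by representatives of distinct cosets of `H` (one for each
coset, counted with multiplicity).  Then `H` is quasiconvex if and only if `ℒ`
is a discrete subset of `C_c⁰(∂G)`. -/
theorem quasiconvex_iff_discrete_family
    {G : Type*} [Group G] (S : Set G) (hSfin : S.Finite)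
    (hSgen : Subgroup.closure S = ⊤) (hhyp : HypD (wdist S))
    (H : Subgroup G)
    (hΛ : (limitSetD (wdist S) (1 : G) (H : Set G)).Nontrivial)
    (R : Set G) (hR : IsCosetReps H R) :
    QCSubgroup S H ↔
      DiscreteFamilyD (wdist S) (1 : G) (fun r : R => cosetLimitSet S H (r : G)) := by
  obtain ⟨δ, hδ0, hδ⟩ := hhyp
  have hd := pmet_wdist hSgen
  constructor
  · rintro ⟨C, hC0, hQC⟩ K hKc ⟨ξ, hξ, η, hη, hne⟩ hinf
    obtain ⟨r₀, hr0, hr₀⟩ : ∃ r₀ : ℝ, 0 ≤ r₀ ∧ ¬ Near (wdist S) 1 r₀ ξ η := by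
      by_contra hcon
      push Not at hcon
      exact hne (eq_of_near hd hδ0 hδ hcon)
    have hI := hinf _ (Real.exp_pos (-(r₀ + 6 * δ)))
    have key : ∀ i : R, ∃ x, vHdistD (wdist S) 1 (cosetLimitSet S H (i : G)) K
        < Real.exp (-(r₀ + 6 * δ)) →
        x ∈ cosetSet H (i : G) ∧ wdist S 1 x ≤ (r₀ + 6 * δ) + 2 * δ + 3 + C := by
      intro i
      by_cases hi : vHdistD (wdist S) 1 (cosetLimitSet S H (i : G)) K
        < Real.exp (-(r₀ + 6 * δ))
      · obtain ⟨-, h2⟩ := vH_lt ⟨ξ, hξ⟩ (cosetLimitSet_nonempty hSgen hΛ.nonempty (i : G))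
          (by positivity) hi
        obtain ⟨a, ha, haξ⟩ := h2 ξ hξ
        obtain ⟨b, hb, hbη⟩ := h2 η hη
        have hab : ¬ Near (wdist S) 1 (r₀ + 6 * δ) a b := by
          intro hab
          apply hr₀
          have h3 := (haξ.symm hd).trans hd hδ0 hδ hab
          exact (h3.trans hd hδ0 hδ (hbη.mono (by linarith))).mono (by linarith)
        obtain ⟨x, hx, hxd⟩ := coset_meets hSgen hδ hQC ha hb hab
        exact ⟨x, fun _ => ⟨hx, hxd⟩⟩
      · exact ⟨1, fun h => (hi h).elim⟩
    choose x hx using key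
    refine Set.infinite_of_injOn_mapsTo (f := x) ?_ ?_ hI
      (wball_finite hSfin hSgen ((r₀ + 6 * δ) + 2 * δ + 3 + C))
    · intro i hi j hj hij
      obtain ⟨_, -, huniq⟩ := hR (x i)
      have hm : ∀ k : R, x k ∈ cosetSet H (k : G) → (x k)⁻¹ * (k : G) ∈ H := by
        intro k hk
        have := H.inv_mem hk
        simpa using this
      have h1 := huniq i ⟨i.2, hm i (hx i hi).1⟩
      have h2 := huniq j ⟨j.2, by rw [hij]; exact hm j (hx j hj).1⟩
      exact Subtype.ext (h1.trans h2.symm)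
    · intro i hi
      exact (hx i hi).2
  · intro hdisc
    by_contra hnot
    obtain ⟨n₀, hn₀⟩ := far_pts hSgen hδ0 hδ hΛ
    have hex : ∀ n : ℕ, ∃ g : R, (n : ℝ) < wdist S 1 (g : G) ∧
        ∃ ξ ∈ cosetLimitSet S H (g : G), ∃ η ∈ cosetLimitSet S H (g : G),
          ¬ Near (wdist S) 1 (4 * δ + 1) ξ η := by
      intro n
      have hq : ¬ QCSetD (wdist S) (max n n₀) (H : Set G) :=
        fun hq => hnot ⟨_, le_trans (Nat.cast_nonneg n) (le_max_left _ _), hq⟩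
      unfold QCSetD at hq
      push Not at hq
      obtain ⟨c, m, hc, h0, hm, i, hi, hlt⟩ := hq
      have hfar : ∀ h ∈ H, max (n : ℝ) n₀ < wdist S (c i) h :=
        fun h hh => hlt.trans_le (pdist_le hd hh)
      obtain ⟨g, ⟨hgR, hg⟩, -⟩ := hR (c i)⁻¹
      rw [inv_inv] at hg
      refine ⟨⟨g, hgR⟩, ?_, ?_⟩
      · have h1 := hfar _ hg
        have h2 := wdist_left S (c i) 1 g
        rw [mul_one] at h2
        rw [h2] at h1
        exact (le_max_left _ _).trans_lt h1
      · refine hn₀ (c 0) h0 (c m) hm (c i) g ?_ ((le_max_right _ _).trans (hfar _ h0).le)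
          ((le_max_right _ _).trans (hfar _ hm).le) hg
        unfold gpD
        have him : (i : ℝ) ≤ m := by exact_mod_cast hi
        rw [hc i hi 0 (Nat.zero_le _), hc i hi m le_rfl, hc 0 (Nat.zero_le _) m le_rfl,
          abs_sub_comm (i : ℝ) m, abs_of_nonneg (show (0 : ℝ) ≤ m - i by linarith)]
        simp
    choose g hg1 hg2 using hex
    obtain ⟨K, hK1, hK2, hK3⟩ := ultralim_sets hd hδ0 hδ (wball_finite hSfin hSgen)
      (fun z n => geo_pt hSgen 1 z n) (hyperfilter ℕ)
      (fun n => cosetLimitSet S H (g n : G)) _ hg2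
    refine hdisc K hK1 hK2 (fun ε hε hfin => ?_)
    have h1 := hK3 ε hε
    obtain ⟨B, hB⟩ := (hfin.image (fun r : R => wdist S 1 (r : G))).bddAbove
    obtain ⟨N, hN⟩ := exists_nat_ge B
    have h2 : ∀ᶠ n in (hyperfilter ℕ : Filter ℕ), N ≤ n := by
      have : ∀ᶠ n in (cofinite : Filter ℕ), N ≤ n := by
        rw [Nat.cofinite_eq_atTop]; exact eventually_ge_atTop N
      exact hyperfilter_le_cofinite this
    obtain ⟨n, hn1, hn2⟩ := (h1.and h2).exists
    have h3 := hB ⟨g n, hn1, rfl⟩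
    have h4 := hg1 n
    have h5 : (N : ℝ) ≤ n := by exact_mod_cast hn2
    simp only at h3
    linarith

end RelRig
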